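/- arXiv:2307.02944 — 2 statements merged into one kernel-verified Lean document; each statement's English description precedes it below -/
import Mathlib

section
/- Let A be a bounded residuated lattice and F a Stone ultrafilter of A. Then for every a ∈ A, if a ∨ ¬a ∈ F then a ∈ F or ¬a ∈ F. -/
universe u

/-- A bounded (integral, commutative) residuated lattice: a bounded lattice
with a commutative monoid operation `mul` (with unit `⊤`) and a residuum
`himp` satisfying the residuation condition. -/
class BRL (α : Type u) extends Lattice α, BoundedOrder α where
  mul : α → α → α
  himp : α → α → α
  mul_comm : ∀ a b : α, mul a b = mul b a
  mul_assoc : ∀ a b c : α, mul (mul a b) c = mul a (mul b c)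
  mul_top : ∀ a : α, mul a ⊤ = a
  residuation : ∀ a b c : α, mul a b ≤ c ↔ a ≤ himp b c

namespace BRL

variable {α : Type u} [BRL α]

/-- `¬a := a → ⊥`. -/
def neg (a : α) : α := himp a ⊥

/-- `a + b := ¬(¬a · ¬b)`. -/
def add (a b : α) : α := neg (mul (neg a) (neg b))

/-- Powers: `a⁰ = ⊤`, `aⁿ⁺¹ = a · aⁿ`. -/
def pow (a : α) : ℕ → α
  | 0 => ⊤
  | n + 1 => mul a (pow a n)

/-- Multiples: `0.a = ⊥`, `(n+1).a = a + n.a`. -/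
def nmul : ℕ → α → α
  | 0, _ => ⊥
  | n + 1, a => add a (nmul n a)

/-- Implicative filter. -/
def IsFilter (F : Set α) : Prop :=
  ⊤ ∈ F ∧ (∀ a b : α, a ∈ F → a ≤ b → b ∈ F) ∧
    (∀ a b : α, a ∈ F → b ∈ F → mul a b ∈ F)

/-- The smallest implicative filter containing `S`. -/
def genFilter (S : Set α) : Set α := ⋂₀ {F : Set α | IsFilter F ∧ S ⊆ F}

/-- Maximal (proper) implicative filter. -/
def IsMaximal (M : Set α) : Prop :=
  IsFilter M ∧ M ≠ Set.univ ∧ ∀ G : Set α, IsFilter G → M ⊂ G → G = Set.univ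

/-- Prime (proper) implicative filter. -/
def IsPrime (P : Set α) : Prop :=
  IsFilter P ∧ P ≠ Set.univ ∧ ∀ a b : α, a ⊔ b ∈ P → a ∈ P ∨ b ∈ P

/-- Minimal prime implicative filter (minimal among prime implicative filters). -/
def IsMinimalPrime (P : Set α) : Prop :=
  IsPrime P ∧ ∀ Q : Set α, IsPrime Q → Q ⊆ P → Q = P

/-- The radical: intersection of all maximal implicative filters. -/
def Rad : Set α := {a : α | ∀ M : Set α, IsMaximal M → a ∈ M}

/-- Boolean (complemented) element. -/
def Boolean (b : α) : Prop := b ⊔ neg b = ⊤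

/-- Stone ultrafilter: an implicative filter generated by an ultrafilter of
the Boolean algebra of Boolean elements. -/
def IsStoneUltra (F : Set α) : Prop :=
  IsFilter F ∧ F = genFilter (F ∩ {b : α | Boolean b}) ∧ (⊥ : α) ∉ F ∧
    ∀ b : α, Boolean b → b ∈ F ∨ neg b ∈ F

theorem mul_mono {a b c d : α} (hac : a ≤ c) (hbd : b ≤ d) : mul a b ≤ mul c d := by
  have h : mul a d ≤ mul c d :=
    (residuation _ _ _).2 (hac.trans ((residuation _ _ _).1 le_rfl))
  refine le_trans ?_ h
  rw [mul_comm a b, mul_comm a d]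
  exact (residuation _ _ _).2 (hbd.trans ((residuation _ _ _).1 le_rfl))

theorem mul_le_left (a b : α) : mul a b ≤ a :=
  (mul_mono le_rfl le_top).trans (mul_top a).le

theorem mul_le_right (a b : α) : mul a b ≤ b :=
  (mul_comm a b).le.trans (mul_le_left b a)

theorem sup_mul_le {a b c d : α} : mul (a ⊔ b) c ≤ d ↔ mul a c ≤ d ∧ mul b c ≤ d := by
  simp only [residuation, sup_le_iff]

theorem mul_sup_le {a b c d : α} : mul c (a ⊔ b) ≤ d ↔ mul c a ≤ d ∧ mul c b ≤ d := by
  rw [mul_comm c, mul_comm c, mul_comm c, sup_mul_le]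

theorem le_neg_iff {a b : α} : a ≤ neg b ↔ mul a b ≤ ⊥ :=
  (residuation a b ⊥).symm

theorem neg_anti {a b : α} (h : a ≤ b) : neg b ≤ neg a :=
  le_neg_iff.2 ((mul_mono le_rfl h).trans (le_neg_iff.1 le_rfl))

theorem Boolean.top : Boolean (⊤ : α) := top_sup_eq _

theorem Boolean.mul {b d : α} (hb : Boolean b) (hd : Boolean d) : Boolean (BRL.mul b d) := by
  refine top_le_iff.1 ?_
  have h : BRL.mul (b ⊔ neg b) (d ⊔ neg d) ≤ BRL.mul b d ⊔ neg (BRL.mul b d) := by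
    refine sup_mul_le.2 ⟨mul_sup_le.2 ⟨le_sup_left, ?_⟩, ?_⟩
    · exact (mul_le_right _ _).trans ((neg_anti (mul_le_right b d)).trans le_sup_right)
    · exact (mul_le_left _ _).trans ((neg_anti (mul_le_left b d)).trans le_sup_right)
  rwa [hb, hd, mul_top] at h

/-- A Boolean element below `a ⊔ ¬a` makes `a` Boolean after multiplication. -/
theorem Boolean.mul_of_le_sup_neg {a b : α} (hb : Boolean b) (h : b ≤ a ⊔ neg a) :
    Boolean (BRL.mul b a) := by
  have hneg : neg b ≤ neg (BRL.mul b a) := neg_anti (mul_le_left b a)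
  have hsq : BRL.mul b b ≤ BRL.mul b a ⊔ neg (BRL.mul b a) :=
    (mul_mono le_rfl h).trans (mul_sup_le.2 ⟨le_sup_left,
      (mul_le_right _ _).trans ((neg_anti (mul_le_right b a)).trans le_sup_right)⟩)
  have hle : BRL.mul b (b ⊔ neg b) ≤ BRL.mul b a ⊔ neg (BRL.mul b a) :=
    mul_sup_le.2 ⟨hsq, (mul_le_right _ _).trans (hneg.trans le_sup_right)⟩
  rw [hb, mul_top] at hle
  exact top_le_iff.1 (hb.ge.trans (sup_le hle (hneg.trans le_sup_right)))

/-- The filter generated by the Boolean elements of a filter is their upward closure. -/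
theorem IsFilter.exists_boolean_le {F : Set α} (hF : IsFilter F) {x : α}
    (hx : x ∈ genFilter (F ∩ {b : α | Boolean b})) : ∃ b ∈ F, Boolean b ∧ b ≤ x := by
  refine hx {y | ∃ b ∈ F, Boolean b ∧ b ≤ y} ⟨⟨?_, ?_, ?_⟩, ?_⟩
  · exact ⟨⊤, hF.1, Boolean.top, le_rfl⟩
  · rintro y z ⟨b, hbF, hb, hby⟩ hyz
    exact ⟨b, hbF, hb, hby.trans hyz⟩
  · rintro y z ⟨b, hbF, hb, hby⟩ ⟨d, hdF, hd, hdz⟩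
    exact ⟨mul b d, hF.2.2 b d hbF hdF, hb.mul hd, mul_mono hby hdz⟩
  · rintro b ⟨hbF, hb⟩
    exact ⟨b, hbF, hb, le_rfl⟩

theorem stone_ultra_di (F : Set α) (hF : IsStoneUltra F) :
    ∀ a : α, a ⊔ neg a ∈ F → a ∈ F ∨ neg a ∈ F := by
  intro a ha
  obtain ⟨hfil, hgen, -, hult⟩ := hF
  obtain ⟨b, hbF, hb, hba⟩ := hfil.exists_boolean_le (hgen.subset ha)
  rcases hult _ (hb.mul_of_le_sup_neg hba) with h | h
  · exact Or.inl (hfil.2.1 _ _ h (mul_le_right b a))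
  · refine Or.inr (hfil.2.1 _ _ (hfil.2.2 _ _ h hbF) (le_neg_iff.2 ?_))
    rw [mul_assoc]
    exact le_neg_iff.1 le_rfl

end BRL
end

section
/- Let A be a bounded residuated lattice in which every Stone ultrafilter is a prime implicative filter. Then the Stone ultrafilters of A are exactly the minimal prime implicative filters of A (minimal with respect to inclusion among prime implicative filters). -/
universe u

namespace BRL

variable {α : Type u} [BRL α]

theorem neg_mul_self (b : α) : mul (neg b) b = ⊥ :=
  le_bot_iff.mp ((residuation _ _ _).mpr le_rfl)

theorem le_neg_neg (b : α) : b ≤ neg (neg b) := by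
  refine (residuation _ _ _).mp ?_
  rw [mul_comm, neg_mul_self]

theorem Boolean.neg {b : α} (hb : Boolean b) : Boolean (neg b) :=
  top_le_iff.mp <| calc
    ⊤ = b ⊔ BRL.neg b := Eq.symm hb
    _ ≤ BRL.neg b ⊔ BRL.neg (BRL.neg b) :=
      sup_le (le_sup_of_le_right (le_neg_neg b)) le_sup_left

theorem isFilter_genFilter (S : Set α) : IsFilter (genFilter S) :=
  ⟨fun _ hF => hF.1.1, fun a b ha hab F hF => hF.1.2.1 a b (ha F hF) hab,
    fun a b ha hb F hF => hF.1.2.2 a b (ha F hF) (hb F hF)⟩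

theorem subset_genFilter (S : Set α) : S ⊆ genFilter S :=
  fun _ ha _ hF => hF.2 ha

theorem genFilter_subset {S F : Set α} (hF : IsFilter F) (hS : S ⊆ F) : genFilter S ⊆ F :=
  fun _ ha => ha F ⟨hF, hS⟩

theorem IsPrime.bot_notMem {P : Set α} (hP : IsPrime P) : (⊥ : α) ∉ P :=
  fun hb => hP.2.1 (Set.eq_univ_of_forall fun a => hP.1.2.1 ⊥ a hb bot_le)

theorem IsPrime.mem_or_neg_mem {P : Set α} (hP : IsPrime P) {b : α} (hb : Boolean b) :
    b ∈ P ∨ neg b ∈ P := by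
  refine hP.2.2 b (neg b) ?_
  rw [show b ⊔ neg b = ⊤ from hb]
  exact hP.1.1

/-- The filter generated by the Boolean elements of a prime filter is a Stone ultrafilter. -/
theorem IsPrime.isStoneUltra_genFilter {P : Set α} (hP : IsPrime P) :
    IsStoneUltra (genFilter (P ∩ {b : α | Boolean b})) := by
  have hsub := subset_genFilter (P ∩ {b : α | Boolean b})
  have hfil := isFilter_genFilter (P ∩ {b : α | Boolean b})
  refine ⟨hfil, Set.Subset.antisymm ?_ (genFilter_subset hfil Set.inter_subset_left),
    fun hb => hP.bot_notMem (genFilter_subset hP.1 Set.inter_subset_left hb), fun b hb => ?_⟩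
  · exact genFilter_subset (isFilter_genFilter _) fun a ha =>
      subset_genFilter _ ⟨hsub ha, ha.2⟩
  · exact (hP.mem_or_neg_mem hb).imp (fun h => hsub ⟨h, hb⟩) (fun h => hsub ⟨h, hb.neg⟩)

/-- A Stone ultrafilter is contained in every prime filter it contains. -/
theorem IsStoneUltra.subset_of_isPrime {F Q : Set α} (hF : IsStoneUltra F) (hQ : IsPrime Q)
    (hQF : Q ⊆ F) : F ⊆ Q := by
  rw [hF.2.1]
  refine genFilter_subset hQ.1 fun b hb => (hQ.mem_or_neg_mem hb.2).resolve_right fun hn => ?_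
  have hbot := hF.1.2.2 _ _ (hQF hn) hb.1
  rw [neg_mul_self] at hbot
  exact hF.2.2.1 hbot

theorem stone_ultra_eq_minimal_prime
    (h : ∀ F : Set α, IsStoneUltra F → IsPrime F) :
    ∀ F : Set α, IsStoneUltra F ↔ IsMinimalPrime F := by
  intro F
  constructor
  · intro hF
    exact ⟨h F hF, fun Q hQ hQF => Set.Subset.antisymm hQF (hF.subset_of_isPrime hQ hQF)⟩
  · rintro ⟨hP, hmin⟩
    have hG := hP.isStoneUltra_genFilter
    rwa [hmin _ (h _ hG) (genFilter_subset hP.1 Set.inter_subset_left)] at hG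

end BRL
end
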